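/- Let A be a commutative Noetherian ring and B a finite flat A-algebra that is projective as an A-module, with I the kernel of the multiplication map m: B⊗_A B → B. Then the canonical A-linear map χ: B⊗_A B → Hom_A(Hom_A(B,A),B), χ(b⊗c)(φ) = φ(b)·c, restricts to an isomorphism of B-modules Ann_{B⊗_A B}(I) ≅ Hom_B(Hom_A(B,A), B), where Hom_A(B,A) is a B-module via (b·φ)(x) = φ(bx), Ann_{B⊗_A B}(I) is a B-module via either factor, and Hom_B denotes B-linear maps. -/

import Mathlib

open TensorProduct

/-- The canonical `A`-linear map `χ : B ⊗_A B → Hom_A(Hom_A(B, A), B)`, sending `b ⊗ c` to the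
homomorphism `φ ↦ φ(b)·c`. -/
noncomputable def chi (A B : Type*) [CommRing A] [CommRing B] [Algebra A B] :
    TensorProduct A B B →ₗ[A] (Module.Dual A B →ₗ[A] B) :=
  (dualTensorHom A (Module.Dual A B) B).comp
    (TensorProduct.map (Module.Dual.eval A B) LinearMap.id)

section

variable {A B : Type*} [CommRing A] [CommRing B] [Algebra A B]

@[simp]
theorem chi_tmul (b c : B) (φ : Module.Dual A B) :
    chi A B (b ⊗ₜ[A] c) φ = φ b • c :=
  rfl

theorem chi_left_mul (b : B) (r : B ⊗[A] B) (φ : Module.Dual A B) :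
    chi A B ((b ⊗ₜ[A] (1 : B)) * r) φ = chi A B r (φ ∘ₗ LinearMap.mulLeft A b) := by
  induction r using TensorProduct.induction_on with
  | zero => simp
  | tmul x y => simp
  | add x y hx hy => simp only [mul_add, map_add, LinearMap.add_apply, hx, hy]

theorem chi_right_mul (b : B) (r : B ⊗[A] B) (φ : Module.Dual A B) :
    chi A B (((1 : B) ⊗ₜ[A] b) * r) φ = b * chi A B r φ := by
  induction r using TensorProduct.induction_on with
  | zero => simp
  | tmul x y => simp
  | add x y hx hy => simp only [mul_add, map_add, LinearMap.add_apply, hx, hy]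

theorem mem_annihilator_ker_lmul'_iff {r : B ⊗[A] B} :
    r ∈ Submodule.annihilator (RingHom.ker (Algebra.TensorProduct.lmul' A (S := B))) ↔
      ∀ b : B, (b ⊗ₜ[A] (1 : B)) * r = ((1 : B) ⊗ₜ[A] b) * r := by
  change r ∈ Submodule.annihilator (KaehlerDifferential.ideal A B) ↔ _
  rw [← KaehlerDifferential.span_range_eq_ideal, Ideal.span, Submodule.mem_annihilator_span]
  simp only [Subtype.forall, Set.forall_mem_range, smul_eq_mul, mul_sub, sub_eq_zero]
  simp only [mul_comm r, eq_comm]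

theorem chi_bijective [Module.Finite A B] [Module.Projective A B] :
    Function.Bijective (chi A B) :=
  (dualTensorHom_bijective (R := A) (M := Module.Dual A B) (N := B)).comp
    (TensorProduct.congr (Module.evalEquiv A B) (LinearEquiv.refl A B)).bijective

/-- An element of `B ⊗ B` annihilates the kernel of multiplication exactly when its image under
`chi` is `B`-linear. -/
theorem mem_annihilator_ker_lmul'_iff_chi [Module.Finite A B] [Module.Projective A B]
    {r : B ⊗[A] B} :
    r ∈ Submodule.annihilator (RingHom.ker (Algebra.TensorProduct.lmul' A (S := B))) ↔
      ∀ (b : B) (φ : Module.Dual A B),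
        chi A B r (φ ∘ₗ LinearMap.mulLeft A b) = b * chi A B r φ := by
  simp only [mem_annihilator_ker_lmul'_iff, ← chi_left_mul, ← chi_right_mul,
    ← LinearMap.ext_iff, chi_bijective.injective.eq_iff]

end

/-- **Scheja–Storch, Lemma 3.2**: `χ` restricts to an isomorphism of `B`-modules
`Ann_{B⊗_A B}(I) ≅ Hom_B(Hom_A(B, A), B)`, where `I = ker(m : B ⊗_A B → B)`.  Here
`Hom_A(B, A)` carries the `B`-module structure `(b·φ)(x) = φ(bx)` (written below as
precomposition with `LinearMap.mulLeft A b`), `Ann_{B⊗_A B}(I)` carries the `B`-module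
structure through either tensor factor, and `B`-linearity of the restriction of `χ` is
expressed pointwise. -/
theorem chi_restricts_to_iso {A B : Type*} [CommRing A] [IsNoetherianRing A]
    [CommRing B] [Algebra A B] [Module.Finite A B] [Module.Flat A B] [Module.Projective A B] :
    -- for `r` in the annihilator of `I`, `χ r` is `B`-linear
    (∀ r ∈ Submodule.annihilator (RingHom.ker (Algebra.TensorProduct.lmul' A (S := B))),
      ∀ (b : B) (φ : Module.Dual A B),
        chi A B r (φ ∘ₗ LinearMap.mulLeft A b) = b * chi A B r φ) ∧
    -- the restriction of `χ` is `B`-linear (for the `B`-action via the left tensor factor on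
    -- the source and post-multiplication on the target)
    (∀ r ∈ Submodule.annihilator (RingHom.ker (Algebra.TensorProduct.lmul' A (S := B))),
      ∀ (b : B) (φ : Module.Dual A B),
        chi A B ((b ⊗ₜ[A] (1 : B)) * r) φ = b * chi A B r φ) ∧
    -- the restriction of `χ` is injective
    Set.InjOn (chi A B)
      (Submodule.annihilator (RingHom.ker (Algebra.TensorProduct.lmul' A (S := B)))) ∧
    -- the image of the restriction of `χ` is exactly `Hom_B(Hom_A(B, A), B)`
    (∀ θ : Module.Dual A B →ₗ[A] B,
      (∀ (b : B) (φ : Module.Dual A B), θ (φ ∘ₗ LinearMap.mulLeft A b) = b * θ φ) →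
      ∃ r ∈ Submodule.annihilator (RingHom.ker (Algebra.TensorProduct.lmul' A (S := B))),
        chi A B r = θ) := by
  refine ⟨fun r hr => mem_annihilator_ker_lmul'_iff_chi.1 hr, fun r hr b φ => ?_,
    chi_bijective.injective.injOn, fun θ hθ => ?_⟩
  · rw [chi_left_mul, mem_annihilator_ker_lmul'_iff_chi.1 hr]
  · obtain ⟨r, rfl⟩ := chi_bijective.surjective θ
    exact ⟨r, mem_annihilator_ker_lmul'_iff_chi.2 hθ, rfl⟩
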